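/- arXiv:2012.09734 — 7 statements merged into one kernel-verified Lean document; each statement's English description precedes it below -/
import Mathlib

section
/- Fix an integer p ≥ 2 and let f : ℂ → ℂ be real-analytic on all of ℂ. Then there exist a real-analytic function h : ℂ × ℂ → ℂ and constants δ > 0 and K > 0 such that: (i) for all z, w ∈ ℂ, (z + z^p·w)^p · f(z + z^p·w) = z^p·f(z) + p·z^{2p−1}·f(z)·w + z^p·h(z, w); and (ii) |h(z, w)| ≤ K·|z|^p·|w| whenever |z| < δ and |w| < δ. -/
open Complex

theorem exists_norm_one_add_pow_sub_le (n : ℕ) :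
    ∃ C : ℝ, 0 ≤ C ∧ ∀ x : ℂ, ‖x‖ ≤ 1 → ‖(1 + x) ^ n - 1 - n * x‖ ≤ C * ‖x‖ ^ 2 := by
  induction n with
  | zero => exact ⟨0, le_rfl, fun x _ => by simp⟩
  | succ n ih =>
    obtain ⟨C, hC, h⟩ := ih
    refine ⟨2 * C + n, by positivity, fun x hx => ?_⟩
    have hx2 : ‖1 + x‖ ≤ 2 := (norm_add_le _ _).trans (by rw [norm_one]; linarith)
    calc ‖(1 + x) ^ (n + 1) - 1 - (n + 1 : ℕ) * x‖
        = ‖(1 + x) * ((1 + x) ^ n - 1 - n * x) + n * x ^ 2‖ := by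
          congr 1; push_cast; ring
      _ ≤ ‖1 + x‖ * ‖(1 + x) ^ n - 1 - n * x‖ + n * ‖x‖ ^ 2 := by
          refine (norm_add_le _ _).trans_eq ?_
          simp
      _ ≤ 2 * (C * ‖x‖ ^ 2) + n * ‖x‖ ^ 2 := by
          gcongr
          exact h x hx
      _ = (2 * C + n) * ‖x‖ ^ 2 := by ring

theorem AnalyticAt.exists_norm_le_and_norm_sub_le {f : ℂ → ℂ} (hf : AnalyticAt ℝ f 0) :
    ∃ r > (0 : ℝ), ∃ M : ℝ, 0 ≤ M ∧ ∀ x y : ℂ, ‖x‖ < r → ‖y‖ < r →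
      ‖f x‖ ≤ M ∧ ‖f x - f y‖ ≤ M * ‖x - y‖ := by
  obtain ⟨L, t, ht, hL⟩ := (hf.contDiffAt (n := 1)).exists_lipschitzOnWith
  have hb : ∀ᶠ x in nhds (0 : ℂ), ‖f x‖ < ‖f 0‖ + 1 :=
    hf.continuousAt.norm.eventually_lt_const (lt_add_one _)
  obtain ⟨r, hr, h⟩ := Metric.eventually_nhds_iff.1 (hb.and ht)
  refine ⟨r, hr, max (‖f 0‖ + 1) L, by positivity, fun x y hx hy => ?_⟩
  have hx' := h (y := x) (by simpa using hx)
  have hy' := h (y := y) (by simpa using hy)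
  refine ⟨hx'.1.le.trans (le_max_left _ _), (hL.norm_sub_le hx'.2 hy'.2).trans ?_⟩
  gcongr
  exact le_max_right _ _

/-- Proposition 2.1 of the paper (algebraic content of the blow-up substitution
`u = z + z^p ũ`): there is a real-analytic remainder `h` with
`(z + z^p w)^p f(z + z^p w) = z^p f(z) + p z^{2p-1} f(z) w + z^p h(z,w)` and
`|h(z,w)| ≤ K |z|^p |w|` near the origin. -/
theorem stmt_2 (p : ℕ) (hp : 2 ≤ p) (f : ℂ → ℂ)
    (hf : AnalyticOnNhd ℝ f Set.univ) :
    ∃ h : ℂ × ℂ → ℂ, AnalyticOnNhd ℝ h Set.univ ∧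
      (∀ z w : ℂ, (z + z ^ p * w) ^ p * f (z + z ^ p * w) =
        z ^ p * f z + (p : ℂ) * z ^ (2 * p - 1) * f z * w + z ^ p * h (z, w)) ∧
      ∃ δ > (0 : ℝ), ∃ K > (0 : ℝ), ∀ z w : ℂ, ‖z‖ < δ → ‖w‖ < δ →
        ‖h (z, w)‖ ≤ K * ‖z‖ ^ p * ‖w‖ := by
  refine ⟨fun q => (1 + q.1 ^ (p - 1) * q.2) ^ p * f (q.1 + q.1 ^ p * q.2) - f q.1
    - p * q.1 ^ (p - 1) * f q.1 * q.2, fun q _ => ?_, fun z w => ?_, ?_⟩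
  · have hz : AnalyticAt ℝ (fun q : ℂ × ℂ => q.1) q := analyticAt_fst
    have hw : AnalyticAt ℝ (fun q : ℂ × ℂ => q.2) q := analyticAt_snd
    have h₁ : AnalyticAt ℝ (fun q : ℂ × ℂ => f q.1) q := (hf q.1 trivial).fun_comp hz
    have h₂ : AnalyticAt ℝ (fun q : ℂ × ℂ => f (q.1 + q.1 ^ p * q.2)) q :=
      (hf (q.1 + q.1 ^ p * q.2) trivial).fun_comp (f := fun q : ℂ × ℂ => q.1 + q.1 ^ p * q.2)
        (hz.add ((hz.pow p).mul hw))
    exact ((((analyticAt_const.add ((hz.pow (p - 1)).mul hw)).pow p).mul h₂).sub h₁).sub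
      (((analyticAt_const.mul (hz.pow (p - 1))).mul h₁).mul hw)
  · obtain ⟨k, rfl⟩ : ∃ k, p = k + 1 := ⟨p - 1, by omega⟩
    have h₁ : z + z ^ (k + 1) * w = z * (1 + z ^ k * w) := by ring
    have h₂ : 2 * (k + 1) - 1 = (k + 1) + k := by omega
    simp only [h₂, Nat.add_sub_cancel]
    rw [h₁, mul_pow, pow_add z (k + 1) k]
    ring
  · obtain ⟨C, hC, hpow⟩ := exists_norm_one_add_pow_sub_le p
    obtain ⟨r, hr, M, hM, hfM⟩ := (hf 0 trivial).exists_norm_le_and_norm_sub_le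
    refine ⟨min 1 (r / 2), by positivity, 2 ^ p * M + M * C + 1, by positivity,
      fun z w hz hw => ?_⟩
    obtain ⟨hz1, hzr⟩ := lt_min_iff.1 hz
    obtain ⟨hw1, hwr⟩ := lt_min_iff.1 hw
    have hx : ‖z ^ (p - 1) * w‖ ≤ 1 := by
      rw [norm_mul, norm_pow]
      exact mul_le_one₀ (pow_le_one₀ (norm_nonneg _) hz1.le) (norm_nonneg _) hw1.le
    have hx2 : ‖1 + z ^ (p - 1) * w‖ ≤ 2 :=
      (norm_add_le _ _).trans (by rw [norm_one]; linarith)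
    have hzw : ‖z ^ p * w‖ ≤ ‖w‖ := by
      rw [norm_mul, norm_pow]
      exact mul_le_of_le_one_left (norm_nonneg _) (pow_le_one₀ (norm_nonneg _) hz1.le)
    obtain ⟨-, hlip⟩ := hfM (z + z ^ p * w) z
      ((norm_add_le _ _).trans_lt (by linarith)) (by linarith)
    obtain ⟨hfz, -⟩ := hfM z z (by linarith) (by linarith)
    rw [add_sub_cancel_left, norm_mul, norm_pow] at hlip
    have hsq : ‖z ^ (p - 1) * w‖ ^ 2 ≤ ‖z‖ ^ p * ‖w‖ := by
      rw [norm_mul, norm_pow, mul_pow, ← pow_mul]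
      gcongr ?_ * ?_
      · exact pow_le_pow_of_le_one (norm_nonneg _) hz1.le (by omega)
      · exact pow_le_of_le_one (norm_nonneg _) hw1.le two_ne_zero
    calc _ = ‖(1 + z ^ (p - 1) * w) ^ p * (f (z + z ^ p * w) - f z)
          + f z * ((1 + z ^ (p - 1) * w) ^ p - 1 - p * (z ^ (p - 1) * w))‖ := by
          congr 1; ring
      _ ≤ ‖1 + z ^ (p - 1) * w‖ ^ p * ‖f (z + z ^ p * w) - f z‖
          + ‖f z‖ * ‖(1 + z ^ (p - 1) * w) ^ p - 1 - p * (z ^ (p - 1) * w)‖ := by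
          refine (norm_add_le _ _).trans_eq ?_
          rw [norm_mul, norm_mul, norm_pow]
      _ ≤ 2 ^ p * (M * (‖z‖ ^ p * ‖w‖)) + M * (C * (‖z‖ ^ p * ‖w‖)) := by
          gcongr
          exact (hpow _ hx).trans (by gcongr)
      _ ≤ (2 ^ p * M + M * C + 1) * ‖z‖ ^ p * ‖w‖ := by
          have : 0 ≤ ‖z‖ ^ p * ‖w‖ := by positivity
          linarith
end

section
/- Fix an integer p ≥ 2 and let f : ℂ → ℂ be real-analytic on all of ℂ with f(0) ≠ 0. Then there exist ρ₀ > 0 and C > 0 (depending only on p and f) such that: for every differentiable function z : [0,∞) → ℂ satisfying z′(t) = i·z(t)^p·f(z(t)) for all t ≥ 0, with |z(0)| ≤ ρ₀ and Re( conj(z(0)) · i·z(0)^p·f(z(0)) ) ≤ 0, one has ∫₀^∞ |z(t)|^p dt ≤ C·|z(0)|. -/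
open Complex MeasureTheory

/-- A solution of a scalar linear equation on `[0, ∞)` is a nonzero multiple of its initial
value at each time. -/
lemma exists_eq_mul_exp_of_hasDerivWithinAt {z a : ℝ → ℂ} (ha : ContinuousOn a (Set.Ici 0))
    (hz : ∀ t : ℝ, 0 ≤ t → HasDerivWithinAt z (a t * z t) (Set.Ici 0) t) {t : ℝ} (ht : 0 ≤ t) :
    ∃ w : ℂ, z t = z 0 * Complex.exp w := by
  set b : ℝ → ℂ := fun s => a (max s 0) with hb
  have hbc : Continuous b :=
    ha.comp_continuous (by fun_prop) fun s => le_max_right s 0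
  set A : ℝ → ℂ := fun s => ∫ x in (0 : ℝ)..s, b x with hA
  have hAd (s : ℝ) : HasDerivAt A (b s) s := hbc.integral_hasStrictDerivAt 0 s |>.hasDerivAt
  have hd (s : ℝ) (hs : 0 ≤ s) :
      HasDerivWithinAt (fun x => z x * Complex.exp (-A x)) 0 (Set.Ici 0) s := by
    have h := (hz s hs).mul (((hAd s).hasDerivWithinAt (s := Set.Ici 0)).neg.cexp)
    refine h.congr_deriv ?_
    simp only [hb, max_eq_left hs, Pi.neg_apply]
    ring
  have hconst := constant_of_has_deriv_right_zero (a := 0) (b := t)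
    (fun s hs => ((hd s hs.1).continuousWithinAt).mono Set.Icc_subset_Ici_self)
    (fun s hs => (hd s hs.1).mono (Set.Ici_subset_Ici.2 hs.1)) t ⟨ht, le_rfl⟩
  have hA0 : A 0 = 0 := by simp [hA]
  simp only [hA0, neg_zero, Complex.exp_zero, mul_one] at hconst
  refine ⟨A t, ?_⟩
  rw [← hconst, mul_assoc, ← Complex.exp_add, neg_add_cancel, Complex.exp_zero, mul_one]

/-- Continuity method: a bound that strictly improves itself on every initial interval
persists for all times. -/
lemma lt_of_bootstrap {φ : ℝ → ℝ} {c : ℝ} (hφ : ContinuousOn φ (Set.Ici 0)) (h0 : φ 0 < c)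
    (h : ∀ T, 0 ≤ T → (∀ t ∈ Set.Icc 0 T, φ t ≤ c) → φ T < c) {t : ℝ} (ht : 0 ≤ t) :
    φ t < c := by
  by_contra! hct
  have hφt : ContinuousOn φ (Set.Icc 0 t) := hφ.mono Set.Icc_subset_Ici_self
  have hclosed : IsClosed (Set.Icc 0 t ∩ φ ⁻¹' Set.Ici c) :=
    hφt.preimage_isClosed_of_isClosed isClosed_Icc isClosed_Ici
  have hcompact : IsCompact (Set.Icc 0 t ∩ φ ⁻¹' Set.Ici c) :=
    isCompact_Icc.of_isClosed_subset hclosed Set.inter_subset_left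
  obtain ⟨T, ⟨hT, hcT⟩, hmin⟩ := hcompact.exists_isLeast ⟨t, ⟨ht, le_rfl⟩, hct⟩
  obtain ⟨S, hS, hφS⟩ := intermediate_value_Icc hT.1
    (hφ.mono Set.Icc_subset_Ici_self) ⟨h0.le, hcT⟩
  have hTS : T ≤ S := hmin ⟨⟨hS.1, hS.2.trans hT.2⟩, hφS.ge⟩
  obtain rfl : S = T := le_antisymm hS.2 hTS
  refine (h S hS.1 fun s hs => ?_).ne hφS
  by_contra! hlt
  have : S ≤ s := hmin ⟨⟨hs.1, hs.2.trans hT.2⟩, hlt.le⟩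
  obtain rfl : s = S := le_antisymm hs.2 this
  exact hlt.ne' hφS

/-- A point of an almost-left half-plane, moved left by `s` up to a small relative error, ends up
at distance at least `(‖v‖ + s) / 2` from the origin. -/
lemma half_add_le_norm_of_re_le {v w : ℂ} {s : ℝ} (hs : 0 ≤ s) (hv : v.re ≤ ‖v‖ / 10)
    (hw : ‖w - v + s‖ ≤ s / 10) : (‖v‖ + s) / 2 ≤ ‖w‖ := by
  have hv0 := norm_nonneg v
  have hsq : (6 / 10 * (‖v‖ + s)) ^ 2 ≤ ‖v - s‖ ^ 2 := by
    have h1 : ‖v - s‖ ^ 2 = ‖v‖ ^ 2 - 2 * s * v.re + s ^ 2 := by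
      rw [Complex.sq_norm, Complex.sq_norm, Complex.normSq_apply, Complex.normSq_apply]
      simp
      ring
    rw [h1]
    nlinarith [mul_le_mul_of_nonneg_left hv hs, sq_nonneg (‖v‖ - s), mul_nonneg hs hv0]
  have hlow : 6 / 10 * (‖v‖ + s) ≤ ‖v - s‖ :=
    le_of_sq_le_sq hsq (norm_nonneg _)
  have htri : ‖v - s‖ ≤ ‖w‖ + ‖w - v + s‖ := by
    have : v - s = w - (w - v + s) := by ring
    rw [this]
    exact norm_sub_le _ _
  linarith

/-- If `u * b` has nonpositive real part and `b` is close to `a`, then `(a * u)⁻¹`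
lies in an almost-left half-plane. -/
lemma inv_re_le_of_re_nonpos {u a b : ℂ} (hu : u ≠ 0) (ha : a ≠ 0) (hre : (u * b).re ≤ 0)
    (hab : ‖b / a - 1‖ ≤ 1 / 10) : ((a * u)⁻¹).re ≤ ‖(a * u)⁻¹‖ / 10 := by
  set x := a * u with hx
  set q := b / a with hq
  have hx0 : x ≠ 0 := mul_ne_zero ha hu
  have hxq : u * b = x * q := by rw [hx, hq]; field_simp
  have h1 : x.re ≤ ‖x‖ / 10 := by
    have h2 : x.re = (x * q).re - (x * (q - 1)).re := by
      rw [← Complex.sub_re]; congr 1; ring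
    have h3 : -(x * (q - 1)).re ≤ ‖x‖ * (1 / 10) := by
      calc -(x * (q - 1)).re ≤ |(x * (q - 1)).re| := neg_le_abs _
        _ ≤ ‖x * (q - 1)‖ := Complex.abs_re_le_norm _
        _ = ‖x‖ * ‖q - 1‖ := norm_mul _ _
        _ ≤ ‖x‖ * (1 / 10) := by gcongr
    rw [hxq] at hre
    linarith
  have hxn : 0 < ‖x‖ := norm_pos_iff.2 hx0
  rw [Complex.inv_re, norm_inv, Complex.normSq_eq_norm_sq]
  calc x.re / ‖x‖ ^ 2 ≤ (‖x‖ / 10) / ‖x‖ ^ 2 := by gcongr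
    _ = ‖x‖⁻¹ / 10 := by field_simp

/-- Decay of a nonvanishing solution as long as it stays where `f` is close to `f 0`. -/
lemma norm_pow_mul_le_of_solution {m : ℕ} {f : ℂ → ℂ} (hf0 : f 0 ≠ 0) {z : ℝ → ℂ}
    (hz : ∀ t : ℝ, 0 ≤ t →
      HasDerivWithinAt z (Complex.I * z t ^ (m + 1) * f (z t)) (Set.Ici 0) t)
    (hne : ∀ t, 0 ≤ t → z t ≠ 0)
    (hre : ((starRingEnd ℂ) (z 0) * (Complex.I * z 0 ^ (m + 1) * f (z 0))).re ≤ 0)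
    {T : ℝ} (hT : 0 ≤ T) (hclose : ∀ t ∈ Set.Icc 0 T, ‖f (z t) / f 0 - 1‖ ≤ 1 / 10) :
    ‖z T‖ ^ m * (1 + m * ‖f 0‖ * ‖z 0‖ ^ m * T) ≤ 2 * ‖z 0‖ ^ m := by
  set c : ℂ := f 0 * Complex.I with hc
  have hc0 : c ≠ 0 := mul_ne_zero hf0 Complex.I_ne_zero
  set v : ℝ → ℂ := fun t => (c * z t ^ m)⁻¹ with hv
  have hvn (t : ℝ) : ‖v t‖ = (‖f 0‖ * ‖z t‖ ^ m)⁻¹ := by simp [hv, hc]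
  have hvd (t : ℝ) (ht : 0 ≤ t) :
      HasDerivWithinAt v (-(m * (f (z t) / f 0))) (Set.Ici 0) t := by
    have hzt := hne t ht
    have h := (((hz t ht).fun_pow m).const_mul c).fun_inv (mul_ne_zero hc0 (pow_ne_zero m hzt))
    refine h.congr_deriv ?_
    rcases m with _ | m
    · simp
    · rw [hc]
      push_cast
      field_simp
      ring
  have hmv := norm_image_sub_le_of_norm_deriv_le_segment' (a := 0) (b := T)
    (f := fun t => v t + m * t) (f' := fun t => -(m * (f (z t) / f 0)) + m) (C := m / 10)
    (fun t ht => by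
      have h1 : HasDerivWithinAt (fun t : ℝ => (m : ℂ) * t) m (Set.Icc 0 T) t := by
        simpa using ((hasDerivAt_id t).ofReal_comp.const_mul (m : ℂ)).hasDerivWithinAt
      exact ((hvd t ht.1).mono Set.Icc_subset_Ici_self).add h1)
    (fun t ht => by
      have h1 : -(m * (f (z t) / f 0)) + m = -(m * (f (z t) / f 0 - 1)) := by ring
      rw [h1, norm_neg, norm_mul, Complex.norm_natCast]
      calc (m : ℝ) * ‖f (z t) / f 0 - 1‖ ≤ m * (1 / 10) := by
            gcongr; exact hclose t ⟨ht.1, ht.2.le⟩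
        _ = m / 10 := by ring) T ⟨hT, le_rfl⟩
  have hz0 : z 0 ≠ 0 := hne 0 le_rfl
  have hre' : (Complex.I * z 0 ^ m * f (z 0)).re ≤ 0 := by
    have h1 : (starRingEnd ℂ) (z 0) * (Complex.I * z 0 ^ (m + 1) * f (z 0))
        = ((‖z 0‖ ^ 2 : ℝ) : ℂ) * (Complex.I * z 0 ^ m * f (z 0)) := by
      rw [Complex.ofReal_pow, ← Complex.conj_mul']; ring
    rw [h1, Complex.re_ofReal_mul] at hre
    have : 0 < ‖z 0‖ ^ 2 := by positivity
    exact nonpos_of_mul_nonpos_right hre this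
  have hv0 : (v 0).re ≤ ‖v 0‖ / 10 := by
    have h1 : v 0 = (f 0 * (Complex.I * z 0 ^ m))⁻¹ := by simp only [hv, hc, mul_assoc]
    rw [h1]
    exact inv_re_le_of_re_nonpos (mul_ne_zero Complex.I_ne_zero (pow_ne_zero m hz0)) hf0 hre'
      (hclose 0 ⟨le_rfl, hT⟩)
  have hkey : (‖v 0‖ + m * T) / 2 ≤ ‖v T‖ := by
    refine half_add_le_norm_of_re_le (by positivity) hv0 ?_
    convert hmv using 1
    · congr 1; push_cast; ring
    · ring
  rw [hvn, hvn] at hkey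
  have hf0n : 0 < ‖f 0‖ := norm_pos_iff.2 hf0
  have ha : 0 < ‖z 0‖ ^ m := pow_pos (norm_pos_iff.2 hz0) m
  have hb : 0 < ‖z T‖ ^ m := pow_pos (norm_pos_iff.2 (hne T hT)) m
  generalize ‖z 0‖ ^ m = x at *
  generalize ‖z T‖ ^ m = y at *
  calc y * (1 + m * ‖f 0‖ * x * T)
      = 2 * ‖f 0‖ * x * y * (((‖f 0‖ * x)⁻¹ + m * T) / 2) := by field_simp
    _ ≤ 2 * ‖f 0‖ * x * y * (‖f 0‖ * y)⁻¹ := by gcongr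
    _ = 2 * x := by field_simp

/-- The integral over the half-line of a function with algebraic decay of exponent
`(m + 1) / m`. -/
lemma integrableOn_and_integral_le_of_pow_mul_le {m : ℕ} (hm : m ≠ 0) {g : ℝ → ℝ} {B k : ℝ}
    (hk : 0 < k) (hB : 0 ≤ B) (hg : ContinuousOn g (Set.Ici 0)) (hg0 : ∀ t, 0 ≤ t → 0 ≤ g t)
    (h : ∀ t, 0 ≤ t → g t ^ m * (1 + k * t) ≤ B ^ m) :
    IntegrableOn (fun t => g t ^ (m + 1)) (Set.Ioi 0) ∧
      ∫ t in Set.Ioi (0 : ℝ), g t ^ (m + 1) ≤ B ^ (m + 1) * (m / k) := by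
  have hm0 : (0 : ℝ) < m := by positivity
  set b : ℝ → ℝ := fun t => (1 + k * t) ^ (-(1 / m) : ℝ) with hb
  have hpos {t : ℝ} (ht : 0 ≤ t) : 0 < 1 + k * t := by positivity
  have hbnd (t : ℝ) (ht : 0 ≤ t) : g t ≤ B * b t := by
    have hbt : 0 ≤ b t := Real.rpow_nonneg (hpos ht).le _
    refine le_of_pow_le_pow_left₀ hm (by positivity) ?_
    have hbm : b t ^ m = (1 + k * t)⁻¹ := by
      rw [hb, ← Real.rpow_natCast, ← Real.rpow_mul (hpos ht).le, ← Real.rpow_neg_one]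
      congr 1; field_simp
    rw [mul_pow, hbm, ← div_eq_mul_inv, le_div_iff₀ (hpos ht)]
    exact h t ht
  have hderiv (t : ℝ) (ht : 0 ≤ t) :
      HasDerivAt (fun s => -(m / k) * b s) (b t ^ (m + 1)) t := by
    have h1 : HasDerivAt (fun s : ℝ => 1 + k * s) k t := by
      simpa using ((hasDerivAt_id t).const_mul k).const_add 1
    have h2 := (h1.rpow_const (p := (-(1 / m) : ℝ)) (Or.inl (hpos ht).ne')).const_mul (-(m / k))
    refine h2.congr_deriv ?_
    have h3 : b t ^ (m + 1) = (1 + k * t) ^ (-(1 / m) - 1 : ℝ) := by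
      rw [hb, ← Real.rpow_natCast, ← Real.rpow_mul (hpos ht).le]
      congr 1; push_cast; field_simp; ring
    rw [h3]
    field_simp
  have hlim : Filter.Tendsto (fun s => -(m / k) * b s) Filter.atTop (nhds 0) := by
    have h1 : Filter.Tendsto (fun s : ℝ => 1 + k * s) Filter.atTop Filter.atTop :=
      Filter.tendsto_atTop_add_const_left _ _ (Filter.tendsto_id.const_mul_atTop hk)
    have h2 := (tendsto_rpow_neg_atTop (y := 1 / (m : ℝ)) (by positivity)).comp h1
    simpa only [mul_zero, Function.comp_def] using h2.const_mul (-(m / k) : ℝ)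
  have hbpos (t : ℝ) (ht : t ∈ Set.Ioi (0 : ℝ)) : 0 ≤ b t ^ (m + 1) :=
    pow_nonneg (Real.rpow_nonneg (hpos (Set.mem_Ioi.1 ht).le).le _) _
  have hint : IntegrableOn (fun t => b t ^ (m + 1)) (Set.Ioi 0) :=
    integrableOn_Ioi_deriv_of_nonneg' hderiv hbpos hlim
  have hval : ∫ t in Set.Ioi (0 : ℝ), b t ^ (m + 1) = m / k := by
    rw [integral_Ioi_of_hasDerivAt_of_nonneg' hderiv hbpos hlim]
    simp [hb]
  have hle (t : ℝ) (ht : t ∈ Set.Ioi (0 : ℝ)) :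
      g t ^ (m + 1) ≤ B ^ (m + 1) * b t ^ (m + 1) := by
    rw [← mul_pow]
    exact pow_le_pow_left₀ (hg0 t (Set.mem_Ioi.1 ht).le) (hbnd t (Set.mem_Ioi.1 ht).le) _
  have hgi : IntegrableOn (fun t => g t ^ (m + 1)) (Set.Ioi 0) := by
    refine Integrable.mono' (hint.const_mul (B ^ (m + 1)))
      (((hg.mono Set.Ioi_subset_Ici_self).pow _).aestronglyMeasurable measurableSet_Ioi) ?_
    filter_upwards [ae_restrict_mem measurableSet_Ioi] with t ht
    rw [Real.norm_of_nonneg (pow_nonneg (hg0 t (Set.mem_Ioi.1 ht).le) _)]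
    exact hle t ht
  refine ⟨hgi, ?_⟩
  calc ∫ t in Set.Ioi (0 : ℝ), g t ^ (m + 1)
      ≤ ∫ t in Set.Ioi (0 : ℝ), B ^ (m + 1) * b t ^ (m + 1) :=
        setIntegral_mono_on hgi (hint.const_mul _) measurableSet_Ioi hle
    _ = B ^ (m + 1) * (m / k) := by rw [integral_const_mul, hval]

/-- Proposition 2.4 of the paper: for the homogeneous dynamics `z' = i z^p f(z)`
with `f(0) ≠ 0`, solutions starting in the small stable sector (modulus
non-increasing at time 0) satisfy `∫₀^∞ |z(t)|^p dt ≤ C |z(0)|`. -/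
theorem stmt_3 (p : ℕ) (hp : 2 ≤ p) (f : ℂ → ℂ)
    (hf : AnalyticOnNhd ℝ f Set.univ) (hf0 : f 0 ≠ 0) :
    ∃ ρ₀ > (0 : ℝ), ∃ C > (0 : ℝ), ∀ z : ℝ → ℂ,
      (∀ t : ℝ, 0 ≤ t →
        HasDerivWithinAt z (Complex.I * z t ^ p * f (z t)) (Set.Ici 0) t) →
      ‖z 0‖ ≤ ρ₀ →
      ((starRingEnd ℂ) (z 0) * (Complex.I * z 0 ^ p * f (z 0))).re ≤ 0 →
      IntegrableOn (fun t : ℝ => ‖z t‖ ^ p) (Set.Ioi 0) ∧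
      (∫ t in Set.Ioi (0 : ℝ), ‖z t‖ ^ p) ≤ C * ‖z 0‖ := by
  obtain ⟨m, rfl⟩ : ∃ m, p = m + 1 := ⟨p - 1, by omega⟩
  have hm : m ≠ 0 := by omega
  have hfc : Continuous f := continuousOn_univ.1 hf.continuousOn
  have hf0n : 0 < ‖f 0‖ := norm_pos_iff.2 hf0
  obtain ⟨ρ, hρ, hclose⟩ : ∃ ρ > 0, ∀ w : ℂ, ‖w‖ ≤ ρ → ‖f w / f 0 - 1‖ ≤ 1 / 10 := by
    have hcont : ContinuousAt (fun w => f w / f 0) 0 := (hfc.div_const _).continuousAt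
    obtain ⟨δ, hδ, h⟩ := Metric.continuousAt_iff.1 hcont (1 / 10) (by norm_num)
    refine ⟨δ / 2, by positivity, fun w hw => ?_⟩
    have := h (x := w) (by rw [dist_zero_right]; linarith)
    rw [div_self hf0, dist_eq_norm] at this
    exact this.le
  refine ⟨ρ / 3, by positivity, 2 ^ (m + 1) / ‖f 0‖, by positivity, fun z hz hz0 hre => ?_⟩
  have hzc : ContinuousOn z (Set.Ici 0) := fun t ht => (hz t ht).continuousWithinAt
  have hexp {t : ℝ} (ht : 0 ≤ t) : ∃ w : ℂ, z t = z 0 * Complex.exp w := by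
    refine exists_eq_mul_exp_of_hasDerivWithinAt (a := fun t => Complex.I * z t ^ m * f (z t))
      ?_ (fun t ht => (hz t ht).congr_deriv (by ring)) ht
    exact (continuousOn_const.mul (hzc.pow m)).mul (hfc.comp_continuousOn hzc)
  by_cases h0 : z 0 = 0
  · have hzero : Set.EqOn (fun t : ℝ => ‖z t‖ ^ (m + 1)) (fun _ => 0) (Set.Ioi 0) := by
      intro t ht
      obtain ⟨w, hw⟩ := hexp (Set.mem_Ioi.1 ht).le
      simp [hw, h0]
    refine ⟨integrableOn_zero.congr_fun hzero.symm measurableSet_Ioi, ?_⟩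
    rw [setIntegral_congr_fun measurableSet_Ioi hzero]
    simp [h0]
  have hne (t : ℝ) (ht : 0 ≤ t) : z t ≠ 0 := by
    obtain ⟨w, hw⟩ := hexp ht
    rw [hw]
    exact mul_ne_zero h0 (Complex.exp_ne_zero w)
  have hz0n : 0 < ‖z 0‖ := norm_pos_iff.2 h0
  have hdecay {T : ℝ} (hT : 0 ≤ T) (hle : ∀ t ∈ Set.Icc 0 T, ‖z t‖ ≤ ρ) :
      ‖z T‖ ^ m * (1 + m * ‖f 0‖ * ‖z 0‖ ^ m * T) ≤ (2 * ‖z 0‖) ^ m := by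
    refine (norm_pow_mul_le_of_solution hf0 hz hne hre hT
      fun t ht => hclose _ (hle t ht)).trans ?_
    rw [mul_pow]
    gcongr
    exact le_self_pow₀ one_le_two hm
  have hsmall (t : ℝ) (ht : 0 ≤ t) : ‖z t‖ < ρ := by
    refine lt_of_bootstrap (φ := fun t => ‖z t‖) hzc.norm (by linarith) (fun T hT hle => ?_) ht
    have h1 : ‖z T‖ ^ m ≤ (2 * ‖z 0‖) ^ m :=
      (le_mul_of_one_le_right (by positivity)
        (le_add_of_nonneg_right (by positivity))).trans (hdecay hT hle)
    have h2 := le_of_pow_le_pow_left₀ hm (by positivity) h1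
    linarith
  obtain ⟨hint, hbound⟩ := integrableOn_and_integral_le_of_pow_mul_le (g := fun t => ‖z t‖)
    (B := 2 * ‖z 0‖) (k := m * ‖f 0‖ * ‖z 0‖ ^ m) hm (by positivity) (by positivity) hzc.norm
    (fun t _ => norm_nonneg _) (fun t ht => hdecay ht fun s hs => (hsmall s hs.1).le)
  refine ⟨hint, hbound.trans_eq ?_⟩
  have hm0 : (m : ℝ) ≠ 0 := Nat.cast_ne_zero.2 hm
  field_simp
  ring
end

section
/- Fix an integer p ≥ 2. Let ψ : ℝ → ℂ and φ : ℝ → ℂ be twice continuously differentiable, with ψ(t) ≠ 0 for every t ∈ ℝ, and suppose that the separable function u(t,x) = ψ(t)·φ(x) solves the equation −i u_t = u_xx + u^p, i.e. ψ′(t)·φ(x) = i·( ψ(t)·φ″(x) + ψ(t)^p·φ(x)^p ) for all t, x ∈ ℝ. Then ψ is a constant function or φ is a constant function. -/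
open Complex

/-- A continuous function on the line with values among the roots of a nonzero polynomial is
constant. -/
theorem eq_of_continuous_of_eval_eq_zero {f : ℝ → ℂ} (hf : Continuous f) {P : Polynomial ℂ}
    (hP : P ≠ 0) (h : ∀ x, P.eval (f x) = 0) (x y : ℝ) : f x = f y := by
  have hfin : (Set.range f).Finite := by
    refine P.roots.toFinset.finite_toSet.subset ?_
    rintro _ ⟨z, rfl⟩
    simpa [hP] using h z
  have hconn : IsPreconnected (Set.range f) := isPreconnected_range hf
  have hsub : (Set.range f).Subsingleton := by
    by_contra hns
    exact hconn.infinite_of_nontrivial (Set.not_subsingleton_iff.mp hns) hfin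
  exact hsub ⟨x, rfl⟩ ⟨y, rfl⟩

/-- Proposition 1.6 of the paper: if `u(t,x) = ψ(t) φ(x)` is a separable solution
of `-i u_t = u_xx + u^p` with `ψ` nowhere vanishing, then `ψ` or `φ` is constant. -/
theorem stmt_4 (p : ℕ) (hp : 2 ≤ p) (ψ φ : ℝ → ℂ)
    (hψ : ContDiff ℝ 2 ψ) (hφ : ContDiff ℝ 2 φ)
    (hψ0 : ∀ t : ℝ, ψ t ≠ 0)
    (heq : ∀ t x : ℝ, deriv ψ t * φ x =
      Complex.I * (ψ t * deriv (deriv φ) x + ψ t ^ p * φ x ^ p)) :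
    (∀ s t : ℝ, ψ s = ψ t) ∨ (∀ x y : ℝ, φ x = φ y) := by
  obtain ⟨n, rfl⟩ : ∃ n, p = n + 1 := ⟨p - 1, by omega⟩
  by_cases hconst : ∀ t, ψ t ^ n = ψ 0 ^ n
  · left
    refine eq_of_continuous_of_eval_eq_zero hψ.continuous
      (Polynomial.X_pow_sub_C_ne_zero (show 0 < n by omega) (ψ 0 ^ n)) fun t => ?_
    simp [hconst t]
  · right
    push Not at hconst
    obtain ⟨t, ht⟩ := hconst
    have hquot : ∀ s x, deriv ψ s / ψ s * φ x =
        I * (deriv (deriv φ) x + ψ s ^ n * φ x ^ (n + 1)) := fun s x => by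
      have hs := hψ0 s
      field_simp
      rw [heq s x]
      ring
    have hd : I * (ψ t ^ n - ψ 0 ^ n) ≠ 0 := mul_ne_zero I_ne_zero (sub_ne_zero.mpr ht)
    have hP : (Polynomial.C (I * (ψ t ^ n - ψ 0 ^ n)) * Polynomial.X ^ (n + 1) -
        Polynomial.C (deriv ψ t / ψ t - deriv ψ 0 / ψ 0) * Polynomial.X : Polynomial ℂ) ≠ 0 := by
      intro h0
      have hc := congrArg (fun Q => Polynomial.coeff Q (n + 1)) h0
      simp only [Polynomial.coeff_sub, Polynomial.coeff_C_mul, Polynomial.coeff_X_pow_self,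
        Polynomial.coeff_X_of_ne_one (show n + 1 ≠ 1 by omega), Polynomial.coeff_zero,
        mul_one, mul_zero, sub_zero] at hc
      exact hd hc
    refine eq_of_continuous_of_eval_eq_zero hφ.continuous hP fun x => ?_
    simp only [Polynomial.eval_sub, Polynomial.eval_mul, Polynomial.eval_C, Polynomial.eval_pow,
      Polynomial.eval_X]
    linear_combination hquot 0 x - hquot t x
end

section
/- Fix an integer p ≥ 2 and z₀ ∈ ℂ with Im(z₀^{p−1}) ≥ 0 (equivalently, sin((p−1)·arg z₀) ≥ 0 when z₀ ≠ 0). Define ζ(t) = z₀·(1 − i(p−1)z₀^{p−1}·t)^{−1/(p−1)}, the complex power taken with the principal branch. Then for every t ≥ 0, |ζ(t)|^{2(p−1)} ≤ |z₀|^{2(p−1)} / ( 1 + (p−1)²·|z₀|^{2(p−1)}·t² ). In particular |ζ(t)| is bounded by |z₀| and tends to 0 as t → ∞ when z₀ ≠ 0. -/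
open Complex Filter

lemma sq_norm_one_sub_I_mul_ge {a t : ℝ} (ha : 0 ≤ a) (ht : 0 ≤ t) {u : ℂ} (hu : 0 ≤ u.im) :
    1 + a ^ 2 * ‖u‖ ^ 2 * t ^ 2 ≤ ‖1 - Complex.I * (a : ℂ) * u * (t : ℂ)‖ ^ 2 := by
  have h : 0 ≤ a * t * u.im := by positivity
  rw [Complex.sq_norm, Complex.sq_norm, Complex.normSq_apply, Complex.normSq_apply]
  simp
  nlinarith

theorem stmt_6 (p : ℕ) (hp : 2 ≤ p) (z₀ : ℂ)
    (hz₀ : 0 ≤ (z₀ ^ (p - 1)).im)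
    (ζ : ℝ → ℂ)
    (hζ : ∀ t : ℝ, ζ t =
      z₀ * (1 - Complex.I * ((p : ℂ) - 1) * z₀ ^ (p - 1) * (t : ℂ)) ^ (-(1 / ((p : ℂ) - 1)))) :
    (∀ t : ℝ, 0 ≤ t →
      ‖ζ t‖ ^ (2 * (p - 1)) ≤
        ‖z₀‖ ^ (2 * (p - 1)) / (1 + ((p : ℝ) - 1) ^ 2 * ‖z₀‖ ^ (2 * (p - 1)) * t ^ 2)) ∧
    (∀ t : ℝ, 0 ≤ t → ‖ζ t‖ ≤ ‖z₀‖) ∧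
    (z₀ ≠ 0 → Tendsto (fun t : ℝ => ‖ζ t‖) atTop (nhds 0)) := by
  obtain ⟨n, rfl⟩ : ∃ n, p = n + 1 := ⟨p - 1, by omega⟩
  have hn : 0 < (n : ℝ) := by exact_mod_cast (by omega : 0 < n)
  simp only [Nat.add_sub_cancel, Nat.cast_add, Nat.cast_one, add_sub_cancel_right] at hz₀ hζ ⊢
  set w : ℝ → ℂ := fun t => 1 - Complex.I * ((n : ℝ) : ℂ) * z₀ ^ n * (t : ℂ) with hw
  have norm_ζ (t : ℝ) : ‖ζ t‖ = ‖z₀‖ * ‖w t‖ ^ (-(1 / (n : ℝ))) := by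
    rw [hζ, norm_mul, ← Complex.norm_cpow_real]
    simp [hw]
  have sq_w {t : ℝ} (ht : 0 ≤ t) : 1 + (n : ℝ) ^ 2 * ‖z₀‖ ^ (2 * n) * t ^ 2 ≤ ‖w t‖ ^ 2 := by
    have h := sq_norm_one_sub_I_mul_ge hn.le ht hz₀
    rwa [norm_pow, ← pow_mul, mul_comm n 2] at h
  have one_le_w {t : ℝ} (ht : 0 ≤ t) : 1 ≤ ‖w t‖ := by
    have h := sq_w ht
    have : 0 ≤ (n : ℝ) ^ 2 * ‖z₀‖ ^ (2 * n) * t ^ 2 := by positivity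
    nlinarith [norm_nonneg (w t)]
  refine ⟨fun t ht => ?_, fun t ht => ?_, fun hz => ?_⟩
  · have h : (‖w t‖ ^ (-(1 / (n : ℝ)))) ^ (2 * n) = (‖w t‖ ^ 2)⁻¹ := by
      rw [← Real.rpow_natCast, ← Real.rpow_mul (norm_nonneg _), ← Real.rpow_natCast,
        ← Real.rpow_neg (norm_nonneg _)]
      congr 1
      push_cast
      field_simp
    rw [norm_ζ, mul_pow, h, ← div_eq_mul_inv]
    gcongr
    exact sq_w ht
  · rw [norm_ζ]
    refine mul_le_of_le_one_right (norm_nonneg _)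
      (Real.rpow_le_one_of_one_le_of_nonpos (one_le_w ht) ?_)
    simp
  · have hlim : Tendsto (fun t => ‖w t‖) atTop atTop := by
      have hc : 0 < (n : ℝ) * ‖z₀‖ ^ n := by positivity
      refine tendsto_atTop_mono' _ ?_ (tendsto_id.const_mul_atTop hc)
      filter_upwards [eventually_ge_atTop 0] with t ht
      refine le_of_abs_le (abs_le_of_sq_le_sq ?_ (norm_nonneg _))
      have h := sq_w ht
      rw [pow_mul'] at h
      simp only [id, mul_pow]
      linarith
    have h := ((tendsto_rpow_neg_atTop (one_div_pos.mpr hn)).comp hlim).const_mul ‖z₀‖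
    simpa [norm_ζ, Function.comp_def] using h
end

section
/- Let X be a complex Banach space, g : X → X a map, and λ ∈ ℂ with Re λ > 0. Let P : ℂ → X be continuous on the closed unit disk 𝔻 = {σ ∈ ℂ : |σ| ≤ 1} and differentiable at every point of the open unit disk, with derivative DP(σ) ∈ X, and suppose the invariance equation g(P(σ)) = λ·σ·DP(σ) holds for every σ in the open unit disk. Then for every σ ∈ 𝔻 the function a(t) = P(e^{λ t}·σ) satisfies: a is differentiable at every t < 0 with a′(t) = g(a(t)); a(0) = P(σ); and a(t) → P(0) in X as t → −∞. -/
open Complex Filter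

/-- Lemma 3.2 of the paper (Parameterization Method): if `P` solves the invariance
equation `g(P(σ)) = λ σ DP(σ)` on the unit disk, then for every `σ` in the closed
unit disk, `a(t) = P(e^{λt} σ)` solves `a' = g(a)` for `t < 0`, equals `P(σ)` at
`t = 0`, and tends to the equilibrium `P(0)` as `t → -∞`. -/
theorem stmt_11 {X : Type*} [NormedAddCommGroup X] [NormedSpace ℂ X] [CompleteSpace X]
    (g : X → X) (lam : ℂ) (hlam : 0 < lam.re)
    (P DP : ℂ → X)
    (hPc : ContinuousOn P (Metric.closedBall 0 1))
    (hPd : ∀ σ ∈ Metric.ball (0 : ℂ) 1, HasDerivAt P (DP σ) σ)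
    (hinv : ∀ σ ∈ Metric.ball (0 : ℂ) 1, g (P σ) = (lam * σ) • DP σ) :
    ∀ σ ∈ Metric.closedBall (0 : ℂ) 1,
      (∀ t : ℝ, t < 0 →
        HasDerivAt (fun s : ℝ => P (Complex.exp (lam * s) * σ))
          (g (P (Complex.exp (lam * t) * σ))) t) ∧
      P (Complex.exp (lam * 0) * σ) = P σ ∧
      Tendsto (fun t : ℝ => P (Complex.exp (lam * t) * σ)) atBot (nhds (P 0)) := by
  intro σ hσ
  have hσ1 : ‖σ‖ ≤ 1 := by simpa using hσ
  have hnorm (t : ℝ) : ‖Complex.exp (lam * t)‖ = Real.exp (lam.re * t) := by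
    simp [Complex.norm_exp]
  refine ⟨fun t ht => ?_, by simp, ?_⟩
  · have hmem : Complex.exp (lam * t) * σ ∈ Metric.ball (0 : ℂ) 1 := by
      have hlt : Real.exp (lam.re * t) < 1 :=
        Real.exp_lt_one_iff.mpr (mul_neg_of_pos_of_neg hlam ht)
      rw [mem_ball_zero_iff, norm_mul, hnorm]
      exact (mul_le_of_le_one_right (Real.exp_pos _).le hσ1).trans_lt hlt
    have hcurve : HasDerivAt (fun s : ℝ => Complex.exp (lam * s) * σ)
        (lam * (Complex.exp (lam * t) * σ)) t := by
      have h := (((hasDerivAt_id (t : ℂ)).const_mul lam).cexp.mul_const σ).comp_ofReal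
      refine h.congr_deriv ?_
      simp only [id]
      ring
    rw [hinv _ hmem]
    exact (hPd _ hmem).scomp t hcurve
  · have hzero : Tendsto (fun t : ℝ => Complex.exp (lam * t) * σ) atBot (nhds 0) := by
      have hexp : Tendsto (fun t : ℝ => Complex.exp (lam * t)) atBot (nhds 0) := by
        rw [tendsto_zero_iff_norm_tendsto_zero]
        simp only [hnorm]
        exact Real.tendsto_exp_atBot.comp (tendsto_id.const_mul_atBot hlam)
      simpa using hexp.mul_const σ
    exact (hPd 0 (by simp)).continuousAt.tendsto.comp hzero
end

section
/- Let X and X′ be Banach spaces, A† : X → X′ and A : X′ → X bounded linear operators, with A injective. Let p̄ ∈ X, r₀ > 0, and let f : X → X′ be Fréchet differentiable at every point of the closed ball B_{r₀}(p̄) = {q ∈ X : ‖q − p̄‖ ≤ r₀}. Suppose nonnegative constants Y₀, Z₀, Z₁, Z₂ satisfy: ‖A f(p̄)‖_X ≤ Y₀; ‖I − A∘A†‖_{B(X)} ≤ Z₀; ‖A∘(A† − Df(p̄))‖_{B(X)} ≤ Z₁; and ‖A∘(Df(c) − Df(p̄))‖_{B(X)} ≤ Z₂·r₀ for every c ∈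 B_{r₀}(p̄). If Z₂·r₀² − (1 − Z₁ − Z₀)·r₀ + Y₀ < 0, then there exists a unique p̃ ∈ B_{r₀}(p̄) such that f(p̃) = 0. -/
/-- A contraction of a closed ball that moves the centre by at most `(1 - K) * r` has a unique
fixed point in that ball. -/
theorem existsUnique_isFixedPt_closedBall {X : Type*} [MetricSpace X] [CompleteSpace X]
    {T : X → X} {p : X} {r : ℝ} {K : NNReal} (hr : 0 ≤ r) (hK : K < 1)
    (hT : LipschitzOnWith K T (Metric.closedBall p r)) (hp : dist (T p) p ≤ (1 - K) * r) :
    ∃! x, x ∈ Metric.closedBall p r ∧ Function.IsFixedPt T x := by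
  have hmem : p ∈ Metric.closedBall p r := Metric.mem_closedBall_self hr
  have hmaps : Set.MapsTo T (Metric.closedBall p r) (Metric.closedBall p r) := by
    intro x hx
    have hxr : dist x p ≤ r := hx
    calc dist (T x) p ≤ dist (T x) (T p) + dist (T p) p := dist_triangle _ _ _
      _ ≤ K * r + (1 - K) * r := by
        gcongr
        exact (hT.dist_le_mul x hx p hmem).trans (by gcongr)
      _ = r := by ring
  have hcontr : ContractingWith K (hmaps.restrict T _ _) := ⟨hK, hT.mapsToRestrict hmaps⟩
  obtain ⟨y, hy, hfix, -⟩ := hcontr.exists_fixedPoint' Metric.isClosed_closedBall.isComplete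
    hmaps hmem (edist_ne_top _ _)
  refine ⟨y, ⟨hy, hfix⟩, fun z hz => ?_⟩
  exact congrArg Subtype.val (hcontr.fixedPoint_unique'
    (x := ⟨z, hz.1⟩) (y := ⟨y, hy⟩) (Subtype.ext hz.2) (Subtype.ext hfix))


/-- Theorem 3.5 of the paper: a Newton–Kantorovich type theorem (the radii
polynomial approach). If the bounds `Y₀, Z₀, Z₁, Z₂` hold and the radii
polynomial is negative at `r₀`, then `f` has a unique zero in the closed ball of
radius `r₀` around the approximate solution `p̄`. -/
theorem stmt_13 {X X' : Type*}
    [NormedAddCommGroup X] [NormedSpace ℝ X] [CompleteSpace X]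
    [NormedAddCommGroup X'] [NormedSpace ℝ X'] [CompleteSpace X']
    (Adag : X →L[ℝ] X') (A : X' →L[ℝ] X) (hA : Function.Injective A)
    (pbar : X) (r₀ : ℝ) (hr₀ : 0 < r₀)
    (f : X → X') (Df : X → X →L[ℝ] X')
    (hdf : ∀ c ∈ Metric.closedBall pbar r₀, HasFDerivAt f (Df c) c)
    (Y₀ Z₀ Z₁ Z₂ : ℝ) (hY₀ : 0 ≤ Y₀) (hZ₀ : 0 ≤ Z₀) (hZ₁ : 0 ≤ Z₁) (hZ₂ : 0 ≤ Z₂)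
    (hY : ‖A (f pbar)‖ ≤ Y₀)
    (hZ0 : ‖ContinuousLinearMap.id ℝ X - A.comp Adag‖ ≤ Z₀)
    (hZ1 : ‖A.comp (Adag - Df pbar)‖ ≤ Z₁)
    (hZ2 : ∀ c ∈ Metric.closedBall pbar r₀, ‖A.comp (Df c - Df pbar)‖ ≤ Z₂ * r₀)
    (hrad : Z₂ * r₀ ^ 2 - (1 - Z₁ - Z₀) * r₀ + Y₀ < 0) :
    ∃! pt : X, pt ∈ Metric.closedBall pbar r₀ ∧ f pt = 0 := by
  set K : ℝ := Z₀ + Z₁ + Z₂ * r₀ with hKdef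
  have hK0 : 0 ≤ K := by positivity
  have hKY : Y₀ ≤ (1 - K) * r₀ := by rw [hKdef]; linarith
  have hK1 : K < 1 := by
    by_contra! h
    nlinarith [mul_nonneg (sub_nonneg.2 h) hr₀.le]
  have hderiv : ∀ c ∈ Metric.closedBall pbar r₀, HasFDerivWithinAt (fun x => x - A (f x))
      (ContinuousLinearMap.id ℝ X - A.comp (Df c)) (Metric.closedBall pbar r₀) c :=
    fun c hc => ((hasFDerivAt_id c).sub (A.hasFDerivAt.comp c (hdf c hc))).hasFDerivWithinAt
  have hbound : ∀ c ∈ Metric.closedBall pbar r₀,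
      ‖ContinuousLinearMap.id ℝ X - A.comp (Df c)‖ ≤ K := by
    intro c hc
    have hsplit : ContinuousLinearMap.id ℝ X - A.comp (Df c) =
        (ContinuousLinearMap.id ℝ X - A.comp Adag) + A.comp (Adag - Df pbar)
          - A.comp (Df c - Df pbar) := by
      simp only [ContinuousLinearMap.comp_sub]
      abel
    rw [hsplit]
    exact (norm_sub_le _ _).trans
      (add_le_add ((norm_add_le _ _).trans (add_le_add hZ0 hZ1)) (hZ2 c hc))
  have hlip : LipschitzOnWith ⟨K, hK0⟩ (fun x => x - A (f x)) (Metric.closedBall pbar r₀) :=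
    (convex_closedBall pbar r₀).lipschitzOnWith_of_nnnorm_hasFDerivWithin_le hderiv hbound
  have hcentre : dist (pbar - A (f pbar)) pbar ≤ (1 - K) * r₀ := by
    simpa [dist_eq_norm] using hY.trans hKY
  have hzero : ∀ x, Function.IsFixedPt (fun x => x - A (f x)) x ↔ f x = 0 := fun x => by
    rw [Function.IsFixedPt, sub_eq_self, map_eq_zero_iff A hA]
  simpa only [hzero] using existsUnique_isFixedPt_closedBall hr₀.le hK1 hlip hcentre
end

section
/- Let ν ≥ 1 and K ∈ ℕ. Let a = (a_k)_{k≥0} with |a|_ν = Σ_{k≥0} |a_k| ω_k < ∞ and let v = (v_k)_{k≥0} with |v|_ν ≤ 1. Define v̂ by v̂_k = 0 for 0 ≤ k ≤ K and v̂_k = v_k for k > K. Then for every k ≥ 0, |(a * v̂)_k| ≤ Ψ_k(a) := sup_{k′ ≥ K+1} | a_{|k−k′|} + a_{k+k′} | / (2 ν^{k′}), where * is the symmetric discrete convolution. Moreover, if a_j = 0 for all j ≥ K+1, then for each k with 0 ≤ k ≤ K one has Ψ_k(a) = max_{ℓ = K+1, …, k+K} |a_{|k−ℓ|}| / (2 ν^{ℓ}).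 -/
/-- The weights `ω_0 = 1`, `ω_k = 2 ν^k` for `k ≥ 1` of the space `ℓ¹_ν`. -/
noncomputable def wgt (ν : ℝ) (k : ℕ) : ℝ := if k = 0 then 1 else 2 * ν ^ k

lemma natAbs_intCast_sub_neg (k n : ℕ) : ((k : ℤ) - -(n : ℤ)).natAbs = k + n := by omega

lemma one_le_wgt {ν : ℝ} (hν : 1 ≤ ν) (k : ℕ) : 1 ≤ wgt ν k := by
  unfold wgt
  split_ifs
  · exact le_rfl
  · linarith [one_le_pow₀ hν (n := k)]

lemma summable_norm_of_summable_wgt {ν : ℝ} (hν : 1 ≤ ν) {a : ℕ → ℂ}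
    (ha : Summable fun k => ‖a k‖ * wgt ν k) : Summable fun k => ‖a k‖ :=
  ha.of_nonneg_of_le (fun _ => norm_nonneg _)
    fun k => le_mul_of_one_le_right (norm_nonneg _) (one_le_wgt hν k)

/-- The symmetric convolution with a sequence vanishing at `0`, folded to a sum over `ℕ`. -/
lemma tsum_symmConv_eq_tsum_nat {a b : ℕ → ℂ} {M : ℝ} (hM : ∀ n, ‖a n‖ ≤ M)
    (hb : Summable fun n => ‖b n‖) (hb0 : b 0 = 0) (k : ℕ) :
    ∑' j : ℤ, a j.natAbs * b ((k : ℤ) - j).natAbs =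
      ∑' n : ℕ, (a ((k : ℤ) - (n : ℤ)).natAbs + a (k + n)) * b n := by
  have hs : ∀ u : ℕ → ℕ, Summable fun n => a (u n) * b n := fun u =>
    Summable.of_norm_bounded (hb.mul_left M) fun n => by
      rw [norm_mul]
      exact mul_le_mul_of_nonneg_right (hM _) (norm_nonneg _)
  rw [← (Equiv.subLeft (k : ℤ)).tsum_eq]
  simp only [Equiv.subLeft_apply, sub_sub_cancel]
  have h₁ := (hs fun n => ((k : ℤ) - (n : ℤ)).natAbs).hasSum
  have h₂ := (hs fun n => k + n).hasSum
  have h := HasSum.of_nat_of_neg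
    (f := fun j : ℤ => a ((k : ℤ) - j).natAbs * b j.natAbs)
    (by simpa only [Int.natAbs_natCast] using h₁)
    (by simpa only [Int.natAbs_neg, Int.natAbs_natCast, natAbs_intCast_sub_neg] using h₂)
  rw [h.tsum_eq]
  simp only [Int.natAbs_zero, hb0, mul_zero, sub_zero, add_mul]
  exact (h₁.add h₂).tsum_eq.symm

lemma norm_add_div_le_iSup {ν : ℝ} (hν : 1 ≤ ν) {a : ℕ → ℂ} {M : ℝ} (hM : ∀ n, ‖a n‖ ≤ M)
    (K k : ℕ) {n : ℕ} (hn : K + 1 ≤ n) :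
    ‖a ((k : ℤ) - (n : ℤ)).natAbs + a (k + n)‖ / (2 * ν ^ n) ≤
      ⨆ (k' : ℕ) (_ : K + 1 ≤ k'),
        ‖a ((k : ℤ) - (k' : ℤ)).natAbs + a (k + k')‖ / (2 * ν ^ k') := by
  have hM0 : 0 ≤ M := (norm_nonneg _).trans (hM 0)
  have hbdd : BddAbove (Set.range fun k' : ℕ => ⨆ (_ : K + 1 ≤ k'),
      ‖a ((k : ℤ) - (k' : ℤ)).natAbs + a (k + k')‖ / (2 * ν ^ k')) := by
    refine ⟨M, ?_⟩
    rintro _ ⟨m, rfl⟩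
    refine Real.iSup_le (fun _ => ?_) hM0
    have hp : 1 ≤ ν ^ m := one_le_pow₀ hν
    rw [div_le_iff₀ (by positivity)]
    calc _ ≤ M + M := (norm_add_le _ _).trans (add_le_add (hM _) (hM _))
      _ ≤ M * (2 * ν ^ m) := by nlinarith
  refine le_ciSup_of_le hbdd n ?_
  rw [ciSup_pos hn]

/-- Corollary 3.7 of the paper: bound `Ψ_k(a)` on the action of convolution with
the tail `v̂` of a unit vector `v`, and its computable form when `a` is finitely
supported on `{0,…,K}`. -/
theorem stmt_15 (ν : ℝ) (hν : 1 ≤ ν) (K : ℕ) (a v : ℕ → ℂ)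
    (ha : Summable fun k => ‖a k‖ * wgt ν k)
    (hv : Summable fun k => ‖v k‖ * wgt ν k)
    (hv1 : (∑' k, ‖v k‖ * wgt ν k) ≤ 1)
    (vhat : ℕ → ℂ) (hvhat : ∀ k, vhat k = if k ≤ K then 0 else v k) :
    (∀ k : ℕ,
      ‖∑' j : ℤ, a j.natAbs * vhat ((k : ℤ) - j).natAbs‖ ≤
        ⨆ (k' : ℕ) (_ : K + 1 ≤ k'),
          ‖a ((k : ℤ) - (k' : ℤ)).natAbs + a (k + k')‖ / (2 * ν ^ k')) ∧
    ((∀ j : ℕ, K + 1 ≤ j → a j = 0) → ∀ k : ℕ, k ≤ K →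
      (⨆ (k' : ℕ) (_ : K + 1 ≤ k'),
          ‖a ((k : ℤ) - (k' : ℤ)).natAbs + a (k + k')‖ / (2 * ν ^ k'))
        = ⨆ ℓ ∈ Finset.Icc (K + 1) (k + K),
            ‖a ((k : ℤ) - (ℓ : ℤ)).natAbs‖ / (2 * ν ^ ℓ)) := by
  have hν0 : 0 < ν := by linarith
  refine ⟨fun k => ?_, fun hfin k hk => ?_⟩
  · have hsa := summable_norm_of_summable_wgt hν ha
    have hM : ∀ n, ‖a n‖ ≤ ∑' m, ‖a m‖ := fun n => hsa.le_tsum n fun _ _ => norm_nonneg _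
    have hsb : Summable fun n => ‖vhat n‖ :=
      (summable_norm_of_summable_wgt hν hv).of_nonneg_of_le (fun _ => norm_nonneg _) fun n => by
        rw [hvhat]
        split_ifs <;> simp
    rw [tsum_symmConv_eq_tsum_nat hM hsb (by simp [hvhat]) k]
    have hle := fun n => norm_add_div_le_iSup hν hM K k (n := n)
    set Ψ := ⨆ (k' : ℕ) (_ : K + 1 ≤ k'),
      ‖a ((k : ℤ) - (k' : ℤ)).natAbs + a (k + k')‖ / (2 * ν ^ k')
    have hΨ : 0 ≤ Ψ := le_trans (by positivity) (hle (K + 1) le_rfl)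
    refine (tsum_of_norm_bounded (hv.mul_left Ψ).hasSum fun n => ?_).trans ?_
    · have hw : 0 ≤ wgt ν n := zero_le_one.trans (one_le_wgt hν n)
      rw [hvhat]
      split_ifs with h
      · simpa using by positivity
      · have hn := hle n (by omega)
        rw [div_le_iff₀ (by positivity)] at hn
        have hwn : wgt ν n = 2 * ν ^ n := if_neg (by omega)
        rw [norm_mul, hwn]
        exact (mul_le_mul_of_nonneg_right hn (norm_nonneg (v n))).trans_eq (by ring)
    · rw [tsum_mul_left]
      exact mul_le_of_le_one_right hΨ hv1
  · congr 1 with n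
    by_cases hn : K + 1 ≤ n
    · rw [ciSup_pos hn, hfin (k + n) (by omega), add_zero]
      by_cases hn' : n ≤ k + K
      · rw [ciSup_pos (Finset.mem_Icc.2 ⟨hn, hn'⟩)]
      · rw [hfin _ (by omega)]
        simp
    · simp [hn]
end
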